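/- Let Π : ℕ⁴ → ℕ satisfy Π(0,a,b,c) = 4c + 2·bit_0(a) + bit_0(b) and, for all y,a,b,c ∈ ℕ and i ∈ {0,1} with 2y+i ≠ 0, writing N = 2^{|y|}: Π(2y+i, a, b, c) = Π(y, ⌊a/2^N⌋, ⌊b/2^N⌋, Π(y, a mod 2^N, b mod 2^N, c)). Then for all y,a,b,c ∈ ℕ, with N = 2^{|y|}: Π(y,a,b,c) = c·4^N + Σ_{j<N} (2·bit_j(a) + bit_j(b))·4^{N-1-j}; that is, Π(y,a,b,c) is c concatenated with the reversed interleaving of the N low-order bits of a and b. -/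

import Mathlib

/-- `bit j a` is the `j`-th binary digit of `a`. -/
def bit (j a : ℕ) : ℕ := a / 2 ^ j % 2

theorem bit_div_two_pow (j n a : ℕ) : bit j (a / 2 ^ n) = bit (n + j) a := by
  simp only [bit, Nat.div_div_eq_div_mul, pow_add]

theorem bit_mod_two_pow {j n : ℕ} (h : j < n) (a : ℕ) : bit j (a % 2 ^ n) = bit j a := by
  simp only [bit, ← Nat.toNat_testBit, Nat.testBit_mod_two_pow, h, decide_true, Bool.true_and]

theorem size_two_mul_add {y i : ℕ} (hi : i ≤ 1) (h : 2 * y + i ≠ 0) :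
    Nat.size (2 * y + i) = Nat.size y + 1 := by
  obtain rfl | rfl : i = 0 ∨ i = 1 := by omega
  · simpa [Nat.bit] using Nat.size_bit (b := false) (n := y) (by simpa [Nat.bit] using h)
  · simpa [Nat.bit] using Nat.size_bit (b := true) (n := y) (by simp [Nat.bit])

theorem interleave_concat (n a b c : ℕ) :
    (c * 4 ^ n + ∑ j ∈ Finset.range n,
        (2 * bit j (a % 2 ^ n) + bit j (b % 2 ^ n)) * 4 ^ (n - 1 - j)) * 4 ^ n +
      ∑ j ∈ Finset.range n,
        (2 * bit j (a / 2 ^ n) + bit j (b / 2 ^ n)) * 4 ^ (n - 1 - j) =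
    c * 4 ^ (n + n) +
      ∑ j ∈ Finset.range (n + n), (2 * bit j a + bit j b) * 4 ^ (n + n - 1 - j) := by
  rw [Finset.sum_range_add, add_mul, Finset.sum_mul, pow_add, mul_assoc, add_assoc]
  congr 2
  · refine Finset.sum_congr rfl fun j hj => ?_
    have hj := Finset.mem_range.1 hj
    rw [bit_mod_two_pow hj, bit_mod_two_pow hj, mul_assoc, ← pow_add]
    congr 2
    omega
  · refine Finset.sum_congr rfl fun j hj => ?_
    rw [bit_div_two_pow, bit_div_two_pow]
    congr 2
    omega

theorem stmt10 (Pi : ℕ → ℕ → ℕ → ℕ → ℕ)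
    (h0 : ∀ a b c, Pi 0 a b c = 4 * c + 2 * bit 0 a + bit 0 b)
    (hs : ∀ y a b c i, i ≤ 1 → 2 * y + i ≠ 0 →
      Pi (2 * y + i) a b c =
        Pi y (a / 2 ^ 2 ^ Nat.size y) (b / 2 ^ 2 ^ Nat.size y)
          (Pi y (a % 2 ^ 2 ^ Nat.size y) (b % 2 ^ 2 ^ Nat.size y) c)) :
    ∀ y a b c, Pi y a b c =
      c * 4 ^ 2 ^ Nat.size y +
        ∑ j ∈ Finset.range (2 ^ Nat.size y),
          (2 * bit j a + bit j b) * 4 ^ (2 ^ Nat.size y - 1 - j) := by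
  intro y
  induction y using Nat.strong_induction_on with
  | _ y ih =>
    intro a b c
    rcases Nat.eq_zero_or_pos y with rfl | hy
    · rw [h0]
      simp
      ring
    · obtain ⟨z, i, hi, rfl⟩ : ∃ z i, i ≤ 1 ∧ y = 2 * z + i :=
        ⟨y / 2, y % 2, by omega, by omega⟩
      have hz : z < 2 * z + i := by omega
      rw [hs z a b c i hi hy.ne', ih z hz, ih z hz, size_two_mul_add hi hy.ne', pow_succ 2,
        mul_two, interleave_concat]
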